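/- The dimension over ℂ of End_{Σ_N}(V_j) equals the number of partitions of N having exactly N − 2j odd parts. -/

import Mathlib

open Equiv Finset

def Ssign {N : ℕ} (σ τ : Equiv.Perm (Fin N)) : ℤ :=
  (-1) ^ (Finset.univ.filter (fun p : Fin N × Fin N =>
      p.1 < p.2 ∧ τ p.1 = p.2 ∧ σ p.2 < σ p.1)).card

/-- The set of involutions of Σ_N that are products of j disjoint transpositions. -/
def InvolJ (N j : ℕ) : Type := {τ : Equiv.Perm (Fin N) // τ * τ = 1 ∧ τ.support.card = 2 * j}

instance (N j : ℕ) : Fintype (InvolJ N j) := by unfold InvolJ; infer_instance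
instance (N j : ℕ) : DecidableEq (InvolJ N j) := by unfold InvolJ; infer_instance

/-- Conjugation of an involution of length j by σ. -/
def involConj {N j : ℕ} (σ : Equiv.Perm (Fin N)) (τ : InvolJ N j) : InvolJ N j :=
  ⟨σ * τ.1 * σ⁻¹,
   by rw [show σ * τ.1 * σ⁻¹ * (σ * τ.1 * σ⁻¹) = σ * (τ.1 * τ.1) * σ⁻¹ by group, τ.2.1]; simp,
   by rw [Equiv.Perm.support_conj]; simp [τ.2.2]⟩

/-- The representation π_j of Σ_N on the free vector space V_j with basis X_j,
given on basis vectors by π_j(σ)(τ) = S(σ,τ)·στσ⁻¹; here V_j is realized as the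
space of ℂ-valued functions on X_j, with δ_τ as basis. -/
noncomputable def piRep (N j : ℕ) (σ : Equiv.Perm (Fin N)) :
    (InvolJ N j → ℂ) →ₗ[ℂ] (InvolJ N j → ℂ) where
  toFun f := fun κ => (Ssign σ (involConj σ⁻¹ κ).1 : ℂ) * f (involConj σ⁻¹ κ)
  map_add' := by intro f g; funext κ; simp [mul_add]
  map_smul' := by intro c f; funext κ; simp; ring

/-- π_j(σ) sends the basis vector δ_τ to S(σ,τ)·δ_{στσ⁻¹}. -/
theorem piRep_single (N j : ℕ) (σ : Equiv.Perm (Fin N)) (τ : InvolJ N j) :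
    piRep N j σ (Pi.single τ 1 : InvolJ N j → ℂ) =
      (Ssign σ τ.1 : ℂ) • (Pi.single (involConj σ τ) 1 : InvolJ N j → ℂ) := by
  have key : ∀ κ : InvolJ N j, involConj σ⁻¹ κ = τ ↔ κ = involConj σ τ := by
    intro κ
    constructor <;> intro h
    · rw [← h]; apply Subtype.ext; simp [involConj, mul_assoc]
    · rw [h]; apply Subtype.ext; simp [involConj, mul_assoc]
  funext κ
  by_cases hκ : κ = involConj σ τ
  · subst hκ
    have h3 : involConj σ⁻¹ (involConj σ τ) = τ := (key _).2 rfl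
    simp only [piRep, LinearMap.coe_mk, AddHom.coe_mk, Pi.smul_apply, smul_eq_mul,
      Pi.single_eq_same, mul_one]
    rw [h3, Pi.single_eq_same, mul_one]
  · have h2 : involConj σ⁻¹ κ ≠ τ := fun h => hκ ((key κ).1 h)
    simp [piRep, Pi.single_eq_of_ne hκ, Pi.single_eq_of_ne h2]

/-- The space of Σ_N-equivariant endomorphisms of V_j. -/
noncomputable def EndG (N j : ℕ) : Submodule ℂ ((InvolJ N j → ℂ) →ₗ[ℂ] (InvolJ N j → ℂ)) where
  carrier := {T | ∀ σ : Equiv.Perm (Fin N), T ∘ₗ piRep N j σ = piRep N j σ ∘ₗ T}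
  add_mem' := by
    intro a b ha hb σ
    simp only [LinearMap.add_comp, LinearMap.comp_add, ha σ, hb σ]
  zero_mem' := by intro σ; simp
  smul_mem' := by
    intro c a ha σ
    simp only [LinearMap.smul_comp, LinearMap.comp_smul, ha σ]

/-! Generic theory of pairs of involutions. -/

section Pairs
variable {α β : Type*}

theorem kz {k l : Perm α} (hk : k * k = 1) (hl : l * l = 1) (i : ℤ) (x : α) :
    k (((k * l) ^ i) x) = ((k * l) ^ (-i)) (k x) := by
  have h : SemiconjBy k (k * l) (k * l)⁻¹ := by
    unfold SemiconjBy
    have h1 : k⁻¹ = k := inv_eq_of_mul_eq_one_left hk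
    have h2 : l⁻¹ = l := inv_eq_of_mul_eq_one_left hl
    rw [mul_inv_rev, h1, h2, ← mul_assoc, hk, mul_assoc, hk]; simp
  have h2 := (h.zpow_right i).eq
  have h3 := congrArg (fun f : Perm α => f x) h2
  rw [inv_zpow, ← zpow_neg] at h3
  exact h3

theorem lkr {k l : Perm α} (hk : k * k = 1) (x : α) : l x = k ((k * l) x) := by
  have : l = k * (k * l) := by rw [← mul_assoc, hk, one_mul]
  exact congrArg (fun f : Perm α => f x) this

theorem zadd (r : Perm α) (i i' : ℤ) (x : α) : (r ^ i) ((r ^ i') x) = (r ^ (i + i')) x := by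
  rw [zpow_add]; rfl

theorem lz {k l : Perm α} (hk : k * k = 1) (hl : l * l = 1) (i : ℤ) (x : α) :
    l (((k * l) ^ i) x) = ((k * l) ^ (-i - 1)) (k x) := by
  rw [lkr hk]
  have : (k * l) (((k * l) ^ i) x) = ((k * l) ^ (1 + i)) x := by
    rw [← zadd]; simp
  rw [this, kz hk hl]; congr 2; ring_nf

theorem kk {k : Perm α} (hk : k * k = 1) (x : α) : k (k x) = x :=
  congrArg (fun f : Perm α => f x) hk

theorem zeq (r : Perm α) (i i' : ℤ) (x : α) :
    (r ^ i) x = (r ^ i') x ↔ (r ^ (i - i')) x = x := by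
  constructor
  · intro h
    have : (r ^ (-i')) ((r ^ i) x) = (r ^ (-i')) ((r ^ i') x) := by rw [h]
    rw [zadd, zadd] at this
    simpa [sub_eq_add_neg, add_comm] using this
  · intro h
    have : (r ^ i') ((r ^ (i - i')) x) = (r ^ i') x := by rw [h]
    rw [zadd] at this
    simpa using this

theorem zper (r : Perm α) (i : ℤ) (x : α) :
    (r ^ i) x = x ↔ ((MulAction.period r x : ℕ) : ℤ) ∣ i :=
  MulAction.zpow_smul_eq_iff_period_dvd (g := r) (a := x) (j := i)

/-- the point of the orbit of `x` with coordinates `g` -/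
def wpt (k l : Perm α) (x : α) (g : ℤ × Bool) : α := ((k * l) ^ g.1) (if g.2 then k x else x)

/-- `z` lies in the orbit of `x` -/
def OrbRel (k l : Perm α) (x z : α) : Prop := ∃ g, wpt k l x g = z

/-- transitivity -/
def Trans2 (k l : Perm α) : Prop := ∀ x z, OrbRel k l x z

/-- no components which are paths with an even number of vertices -/
def Good (k l : Perm α) : Prop :=
  ∀ x, (k x = x ∨ l x = x) → ∃ m : ℤ, ((k * l) ^ (2 * m + 1)) x = x

theorem k_wpt {k l : Perm α} (hk : k * k = 1) (hl : l * l = 1) (x : α) (i : ℤ) (b : Bool) :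
    k (wpt k l x (i, b)) = wpt k l x (-i, !b) := by
  cases b <;> simp [wpt, kz hk hl, kk hk, -zpow_neg]

theorem l_wpt {k l : Perm α} (hk : k * k = 1) (hl : l * l = 1) (x : α) (i : ℤ) (b : Bool) :
    l (wpt k l x (i, b)) = wpt k l x (-i - 1, !b) := by
  cases b <;> simp [wpt, lz hk hl, kk hk, -zpow_neg]

theorem OrbRel.refl (k l : Perm α) (x : α) : OrbRel k l x x := ⟨(0, false), by simp [wpt]⟩

theorem OrbRel.k {k l : Perm α} (hk : k * k = 1) (hl : l * l = 1) {x z : α} (h : OrbRel k l x z) :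
    OrbRel k l x (k z) := by
  obtain ⟨⟨i, b⟩, rfl⟩ := h
  exact ⟨_, (k_wpt hk hl x i b).symm⟩

theorem OrbRel.l {k l : Perm α} (hk : k * k = 1) (hl : l * l = 1) {x z : α} (h : OrbRel k l x z) :
    OrbRel k l x (l z) := by
  obtain ⟨⟨i, b⟩, rfl⟩ := h
  exact ⟨_, (l_wpt hk hl x i b).symm⟩

theorem OrbRel.z {k l : Perm α} {x z : α} (h : OrbRel k l x z) (i : ℤ) :
    OrbRel k l x (((k * l) ^ i) z) := by
  obtain ⟨⟨i', b⟩, rfl⟩ := h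
  exact ⟨(i + i', b), by simp only [wpt]; rw [zadd]⟩

theorem OrbRel.trans {k l : Perm α} (hk : k * k = 1) (hl : l * l = 1) {x y z : α}
    (h : OrbRel k l x y) (h' : OrbRel k l y z) : OrbRel k l x z := by
  obtain ⟨⟨i, b⟩, rfl⟩ := h'
  cases b
  · exact h.z i
  · exact (h.k hk hl).z i

theorem OrbRel.symm {k l : Perm α} (hk : k * k = 1) (hl : l * l = 1) {x z : α}
    (h : OrbRel k l x z) : OrbRel k l z x := by
  obtain ⟨⟨i, b⟩, rfl⟩ := h
  cases b
  · exact ⟨(-i, false), by simp [wpt, zadd, -zpow_neg]⟩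
  · exact ⟨(i, true), by simp [wpt, kz hk hl, kk hk, -zpow_neg, zadd]⟩

/-- The coincidence relation on coordinates. -/
def Coin (n : ℕ) (g h : ℤ × Bool) : Prop :=
  if Odd n then (n : ℤ) ∣ g.1 - h.1 else g.2 = h.2 ∧ ((n / 2 : ℕ) : ℤ) ∣ g.1 - h.1

theorem norm_form [Fintype α] [Nonempty α] {k l : Perm α} (hk : k * k = 1) (hl : l * l = 1)
    (hT : Trans2 k l) (hG : Good k l) :
    ∃ x, ∀ g h, wpt k l x g = wpt k l x h ↔ Coin (Fintype.card α) g h := by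
  by_cases hf : ∃ x, k x = x
  · obtain ⟨x, hx⟩ := hf
    refine ⟨x, ?_⟩
    have hw : ∀ g, wpt k l x g = ((k * l) ^ g.1) x := by
      rintro ⟨i, b⟩; cases b <;> simp [wpt, hx]
    have hc : Fintype.card α = MulAction.period (k * l) x := by
      classical
      have h1 := MulAction.minimalPeriod_eq_card (a := k * l) (b := x)
      rw [MulAction.period, h1]
      symm
      have : MulAction.orbit (Subgroup.zpowers (k * l)) x = Set.univ := by
        ext z
        simp only [Set.mem_univ, iff_true]
        obtain ⟨g, rfl⟩ := hT x z
        rw [hw]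
        exact ⟨⟨(k * l) ^ g.1, g.1, rfl⟩, rfl⟩
      rw [← Nat.card_eq_fintype_card, ← Nat.card_eq_fintype_card, this]
      exact Nat.card_congr (Equiv.Set.univ α)
    have ho : Odd (Fintype.card α) := by
      obtain ⟨m, hm⟩ := hG x (Or.inl hx)
      rw [zper, ← hc] at hm
      have : Odd ((Fintype.card α : ℕ) : ℤ) := by
        obtain ⟨c, hc⟩ := hm
        have h5 : Odd (((Fintype.card α : ℕ) : ℤ) * c) := by rw [← hc]; exact ⟨m, rfl⟩
        exact (Int.odd_mul.1 h5).1
      exact_mod_cast this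
    intro g h
    rw [hw, hw, zeq, zper, Coin, if_pos ho, hc]
  · push Not at hf
    have hfl : ∀ x, l x ≠ x := by
      intro x hx
      obtain ⟨m, hm⟩ := hG x (Or.inr hx)
      apply hf (((k * l) ^ (m + 1)) x)
      have h1 : k x = (k * l) x := by simp [hx]
      rw [kz hk hl, h1]
      have h2 : (k * l) x = ((k * l) ^ (1 : ℤ)) x := by simp
      rw [h2, zadd, eq_comm, zeq]
      convert hm using 3
      ring
    have hno : ∀ x i, ((k * l) ^ (i : ℤ)) (k x) ≠ x := by
      intro x i hi
      have h3 : k x = ((k * l) ^ (-i)) x := by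
        nth_rewrite 2 [← hi]; rw [zadd]; simp
      rcases Int.even_or_odd' (-i) with ⟨d, hd | hd⟩
      · apply hf (((k * l) ^ d) x)
        rw [kz hk hl, h3, hd, zadd]; congr 2; ring
      · apply hfl (((k * l) ^ d) x)
        rw [lz hk hl, h3, hd, zadd]; congr 2; ring
    obtain ⟨x⟩ := ‹Nonempty α›
    refine ⟨x, ?_⟩
    have hc : Fintype.card α = 2 * MulAction.period (k * l) x := by
      classical
      have h1 := MulAction.minimalPeriod_eq_card (a := k * l) (b := x)
      rw [MulAction.period, h1, ← Nat.card_eq_fintype_card, ← Nat.card_eq_fintype_card]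
      set O := MulAction.orbit (Subgroup.zpowers (k * l)) x with hO
      have hmem : ∀ i : ℤ, ((k * l) ^ i) x ∈ O := fun i => ⟨⟨(k * l) ^ i, i, rfl⟩, rfl⟩
      have hmem' : ∀ z ∈ O, ∃ i : ℤ, ((k * l) ^ i) x = z := by
        rintro z ⟨⟨_, i, rfl⟩, rfl⟩; exact ⟨i, rfl⟩
      have hcomp : Oᶜ = k '' O := by
        ext z
        constructor
        · intro hz
          obtain ⟨⟨i, b⟩, rfl⟩ := hT x z
          cases b
          · exact absurd (hmem i) (by simpa [wpt] using hz)
          · refine ⟨_, hmem (-i), ?_⟩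
            rw [kz hk hl]; simp [wpt]
        · rintro ⟨w, hw, rfl⟩ h2
          obtain ⟨i, rfl⟩ := hmem' _ hw
          obtain ⟨i', hi'⟩ := hmem' _ h2
          rw [kz hk hl] at hi'
          apply hno x (-i' + -i)
          rw [← zadd, ← hi', zadd]; simp
      have h2 := Set.ncard_add_ncard_compl O
      rw [hcomp, Set.ncard_image_of_injective _ k.injective] at h2
      rw [Nat.card_coe_set_eq, ← h2]; ring
    have ho : ¬ Odd (Fintype.card α) := by rw [hc]; simp
    have hd : Fintype.card α / 2 = MulAction.period (k * l) x := by omega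
    intro g h
    rw [Coin, if_neg ho, hd]
    obtain ⟨i, b⟩ := g
    obtain ⟨i', b'⟩ := h
    cases b <;> cases b' <;> simp only [wpt, if_true, if_false, Bool.false_eq_true]
    · rw [zeq, zper]; simp
    · simp only [reduceCtorEq, false_and, iff_false]
      intro h
      apply hno x (-i + i')
      rw [← zadd, ← h, zadd]; simp
    · simp only [reduceCtorEq, false_and, iff_false]
      intro h
      apply hno x (-i' + i)
      rw [← zadd, h, zadd]; simp
    · have e1 : ∀ i : ℤ, ((k * l) ^ i) (k x) = k (((k * l) ^ (-i)) x) := by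
        intro i; rw [kz hk hl]; simp
      rw [e1, e1, k.injective.eq_iff, zeq, zper]
      simp only [true_and]
      rw [← dvd_neg]; congr! 1; ring

theorem iso_of_trans [Fintype α] [Fintype β] [Nonempty α] {k l : Perm α} {k' l' : Perm β}
    (hk : k * k = 1) (hl : l * l = 1) (hk' : k' * k' = 1) (hl' : l' * l' = 1)
    (hT : Trans2 k l) (hG : Good k l) (hT' : Trans2 k' l') (hG' : Good k' l')
    (hc : Fintype.card α = Fintype.card β) :
    ∃ e : α ≃ β, (∀ x, e (k x) = k' (e x)) ∧ (∀ x, e (l x) = l' (e x)) := by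
  have : Nonempty β := by
    rw [← Fintype.card_pos_iff, ← hc]; exact Fintype.card_pos
  obtain ⟨x, hx⟩ := norm_form hk hl hT hG
  obtain ⟨x', hx'⟩ := norm_form hk' hl' hT' hG'
  choose s hs using hT x
  choose s' hs' using hT' x'
  have key : ∀ g h, wpt k l x g = wpt k l x h ↔ wpt k' l' x' g = wpt k' l' x' h := by
    intro g h; rw [hx, hx', hc]
  let e : α ≃ β :=
    { toFun := fun z => wpt k' l' x' (s z)
      invFun := fun z => wpt k l x (s' z)
      left_inv := by
        intro z
        nth_rewrite 2 [← hs z]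
        rw [key, hs']
      right_inv := by
        intro z
        nth_rewrite 2 [← hs' z]
        rw [← key, hs] }
  have he : ∀ g, e (wpt k l x g) = wpt k' l' x' g := by
    intro g
    show wpt k' l' x' (s _) = _
    rw [← key, hs]
  refine ⟨e, ?_, ?_⟩
  · intro z
    obtain ⟨⟨i, b⟩, rfl⟩ := hT x z
    rw [k_wpt hk hl, he, he, k_wpt hk' hl']
  · intro z
    obtain ⟨⟨i, b⟩, rfl⟩ := hT x z
    rw [l_wpt hk hl, he, he, l_wpt hk' hl']

end Pairs

section Signs
variable {N : ℕ}

theorem Ssign_prod (σ τ : Perm (Fin N)) :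
    Ssign σ τ = ∏ x ∈ univ.filter (fun x => x < τ x), (if σ (τ x) < σ x then (-1 : ℤ) else 1) := by
  rw [Ssign, Finset.prod_ite, Finset.prod_const, Finset.prod_const_one, mul_one]
  congr 1
  refine Finset.card_bij' (fun p _ => p.1) (fun x _ => (x, τ x)) ?_ ?_ ?_ ?_
  · rintro ⟨a, b⟩ h
    simp only [mem_filter, mem_univ, true_and] at h ⊢
    obtain ⟨h1, rfl, h3⟩ := h
    exact ⟨h1, h3⟩
  · intro x h
    simp only [mem_filter, mem_univ, true_and] at h ⊢
    exact ⟨h.1, h.2⟩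
  · rintro ⟨a, b⟩ h
    simp only [mem_filter, mem_univ, true_and] at h ⊢
    rw [h.2.1]
  · intro x h; rfl

theorem edge_prod (ρ τ τ' : Perm (Fin N)) (hτ : τ * τ = 1) (h : ∀ x, τ' (ρ x) = ρ (τ x))
    (f : Fin N → ℤ) (hf : ∀ z, f (τ' z) = f z) :
    ∏ x ∈ univ.filter (fun x => x < τ x), f (ρ x) =
      ∏ z ∈ univ.filter (fun z => z < τ' z), f z := by
  have hτ' : ∀ x, τ' (τ' x) = x := by
    intro x
    obtain ⟨y, rfl⟩ := ρ.surjective x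
    rw [h, h, kk hτ]
  have h' : ∀ x, ρ⁻¹ (τ' x) = τ (ρ⁻¹ x) := by
    intro x
    obtain ⟨y, rfl⟩ := ρ.surjective x
    rw [h]; simp
  refine Finset.prod_bij' (fun x _ => if ρ x < ρ (τ x) then ρ x else ρ (τ x))
    (fun z _ => if ρ⁻¹ z < ρ⁻¹ (τ' z) then ρ⁻¹ z else ρ⁻¹ (τ' z)) ?_ ?_ ?_ ?_ ?_
  · intro x hx
    simp only [mem_filter, mem_univ, true_and] at hx ⊢
    have hne : ρ x ≠ ρ (τ x) := fun e => hx.ne (ρ.injective e)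
    split_ifs with h1
    · rwa [h]
    · rw [h, kk hτ]; exact lt_of_le_of_ne (not_lt.1 h1) hne.symm
  · intro x hx
    simp only [mem_filter, mem_univ, true_and] at hx ⊢
    have hne : ρ⁻¹ x ≠ ρ⁻¹ (τ' x) := fun e => hx.ne (ρ⁻¹.injective e)
    split_ifs with h1
    · rwa [← h']
    · rw [← h', hτ']; exact lt_of_le_of_ne (not_lt.1 h1) hne.symm
  · intro x hx
    simp only [mem_filter, mem_univ, true_and] at hx ⊢
    split_ifs with h1 h2 h2 <;> simp_all [kk hτ]
    exact absurd hx (not_lt.2 h2.le)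
  · intro x hx
    simp only [mem_filter, mem_univ, true_and] at hx ⊢
    split_ifs with h1 h2 h2 <;> simp_all [← h]
    exact absurd hx (not_lt.2 h2.le)
  · intro x hx
    split_ifs with h1
    · rfl
    · rw [← h, hf]

theorem Ssign_mul (σ ρ τ : Perm (Fin N)) (hτ : τ * τ = 1) :
    Ssign (σ * ρ) τ = Ssign σ (ρ * τ * ρ⁻¹) * Ssign ρ τ := by
  rw [Ssign_prod, Ssign_prod σ, Ssign_prod ρ]
  set τ' := ρ * τ * ρ⁻¹ with hτ'
  have h : ∀ x, τ' (ρ x) = ρ (τ x) := by intro x; simp [hτ']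
  have hτ'' : ∀ x, τ' (τ' x) = x := by
    intro x
    obtain ⟨y, rfl⟩ := ρ.surjective x
    rw [h, h, kk hτ]
  set f : Fin N → ℤ := fun z => (if σ (τ' z) < σ z then (-1 : ℤ) else 1) *
    (if τ' z < z then (-1 : ℤ) else 1) with hf
  have e1 : ∏ z ∈ univ.filter (fun z => z < τ' z), (if σ (τ' z) < σ z then (-1 : ℤ) else 1) =
      ∏ z ∈ univ.filter (fun z => z < τ' z), f z := by
    refine Finset.prod_congr rfl ?_
    intro z hz
    simp only [mem_filter, mem_univ, true_and] at hz
    simp [hf, not_lt.2 hz.le]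
  have hfs : ∀ z, f (τ' z) = f z := by
    intro z
    simp only [hf, hτ'']
    by_cases hz : τ' z = z
    · simp [hz]
    · have hz2 : σ (τ' z) ≠ σ z := fun e => hz (σ.injective e)
      rcases lt_or_gt_of_ne hz with h1 | h1 <;> rcases lt_or_gt_of_ne hz2 with h2 | h2 <;>
        simp [h1, h2, not_lt.2 h1.le, not_lt.2 h2.le]
  rw [e1, ← edge_prod ρ τ τ' hτ h f hfs, ← Finset.prod_mul_distrib]
  refine Finset.prod_congr rfl ?_
  intro x hx
  simp only [hf, h, Perm.mul_apply]
  by_cases h1 : σ (ρ (τ x)) < σ (ρ x) <;> by_cases h2 : ρ (τ x) < ρ x <;> simp [h1, h2]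

theorem Ssign_sq (σ τ : Perm (Fin N)) : Ssign σ τ * Ssign σ τ = 1 := by
  rw [Ssign, ← mul_pow]; simp

theorem Ssign_comm (σ τ : Perm (Fin N)) (hτ : τ * τ = 1) (h : ∀ x, τ (σ x) = σ (τ x)) 
    (hp : ∀ x, τ (σ x) = σ x ↔ τ x = x) :
    Ssign σ τ = (Perm.sign σ : ℤ) *
      (Perm.sign (σ.subtypePerm (p := fun x => τ x = x) hp) : ℤ) := by
  classical
  have ht := kk hτ
  let E := {x : Fin N // x < τ x}
  have hne : ∀ e : E, σ e.1 ≠ τ (σ e.1) := by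
    intro e he
    exact e.2.ne ((hp _).1 he.symm).symm
  let pf : E → E := fun e => if h1 : σ e.1 < τ (σ e.1) then ⟨σ e.1, h1⟩ else
    ⟨τ (σ e.1), by rw [ht]; exact lt_of_le_of_ne (not_lt.1 h1) (hne e).symm⟩
  have hpf : ∀ e, (pf e).1 = if σ e.1 < τ (σ e.1) then σ e.1 else τ (σ e.1) := by
    intro e; simp only [pf]; split_ifs <;> rfl
  have hinj : Function.Injective pf := by
    intro e e' he
    have h1 := congrArg Subtype.val he
    rw [hpf, hpf] at h1
    have c1 : ∀ e e' : E, e.1 = τ e'.1 → e = e' := by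
      intro e e' h2
      have h3 := e.2
      rw [h2, ht] at h3
      exact absurd h3 (not_lt.2 e'.2.le)
    split_ifs at h1
    · exact Subtype.ext (σ.injective h1)
    · exact c1 _ _ (σ.injective (by rw [h1, h]))
    · exact (c1 _ _ (σ.injective (by rw [← h1, h]))).symm
    · exact Subtype.ext (σ.injective (τ.injective h1))
  let π : Perm E := Equiv.ofBijective pf (Finite.injective_iff_bijective.1 hinj)
  let ε : E → Perm Bool := fun e => if σ (τ e.1) < σ e.1 then Equiv.swap false true else 1
  let g : Perm (E × Bool) := prodCongrLeft (fun _ => π) * prodCongrRight ε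
  let Φ : {x : Fin N // τ x = x} ⊕ (E × Bool) ≃ Fin N :=
    { toFun := Sum.elim (fun x => x.1) (fun q => if q.2 then τ q.1.1 else q.1.1)
      invFun := fun x => if h1 : τ x = x then Sum.inl ⟨x, h1⟩ else
        if h2 : x < τ x then Sum.inr (⟨x, h2⟩, false) else
          Sum.inr (⟨τ x, by rw [ht]; exact lt_of_le_of_ne (not_lt.1 h2) h1⟩, true)
      left_inv := by
        rintro (⟨x, hx⟩ | ⟨⟨x, hx⟩, b⟩)
        · simp [hx]
        · cases b
          · simp [hx, hx.ne']
          · simp [ht, hx.ne, not_lt.2 hx.le]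
      right_inv := by
        intro x
        simp only
        split_ifs <;> simp [ht] }
  have hs : Perm.sign σ = Perm.sign (σ.subtypePerm (p := fun x => τ x = x) hp) * Perm.sign g := by
    rw [← Perm.sign_sumCongr]
    symm
    refine Perm.sign_eq_sign_of_equiv _ _ Φ ?_
    rintro (⟨x, hx⟩ | ⟨e, b⟩)
    · rfl
    · have h4 : ∀ e b, Φ (Sum.inr (e, b)) = if b then τ e.1 else e.1 := fun _ _ => rfl
      have h5 : (Perm.sumCongr (σ.subtypePerm (p := fun x => τ x = x) hp) g) (Sum.inr (e, b)) =
        Sum.inr (π e, ε e b) := rfl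
      rw [h5, h4, h4]
      have h6 : (π e).1 = if σ e.1 < τ (σ e.1) then σ e.1 else τ (σ e.1) := hpf e
      rw [h6]
      have h7 := hne e
      have h8 := h e.1
      have h11 : ε e = if τ (σ e.1) < σ e.1 then Equiv.swap false true else 1 := by
        simp only [ε, h8]
      rw [h11]
      rcases lt_or_gt_of_ne h7 with h9 | h9 <;> cases b <;>
        simp [h9, not_lt.2 h9.le, ht, ← h8]
  have hg : (Perm.sign g : ℤ) = Ssign σ τ := by
    rw [Perm.sign_mul, Perm.sign_prodCongrLeft, Perm.sign_prodCongrRight]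
    simp only [Finset.prod_const, Finset.card_univ, Fintype.card_bool, Int.units_sq, one_mul]
    rw [Ssign_prod, Units.coe_prod]
    rw [Finset.prod_subtype (univ.filter (fun x => x < τ x)) (p := fun x => x < τ x) (by simp)]
    refine Finset.prod_congr rfl ?_
    intro e _
    simp only [ε]
    split_ifs <;> simp
  have h10 : Perm.sign g = Perm.sign σ * Perm.sign (σ.subtypePerm (p := fun x => τ x = x) hp) := by
    rw [hs, mul_comm (Perm.sign (σ.subtypePerm (p := fun x => τ x = x) hp)), mul_assoc,
      Int.units_mul_self, mul_one]
  rw [← hg, h10]; simp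

end Signs

section Stab
variable {N : ℕ}

theorem uniq_aux {α : Type*} (r : Perm α) (z : α) (i m : ℤ) (h1 : (r ^ (2 * i)) z = z)
    (h2 : (r ^ (2 * m + 1)) z = z) : (r ^ i) z = z := by
  rw [zper] at *
  have : i = i * (2 * m + 1) - m * (2 * i) := by ring
  rw [this]
  exact dvd_sub (h2.mul_left _) (h1.mul_left _)

theorem uniq_k {α : Type*} {k l : Perm α} (hk : k * k = 1) (hl : l * l = 1) (hG : Good k l)
    (z : α) (i : ℤ) (hz : k z = z) (hz' : k (((k * l) ^ i) z) = ((k * l) ^ i) z) :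
    ((k * l) ^ i) z = z := by
  obtain ⟨m, hm⟩ := hG z (Or.inl hz)
  refine uniq_aux _ _ i m ?_ hm
  rw [kz hk hl, hz, eq_comm, zeq] at hz'
  convert hz' using 3; ring

theorem kfix_of_l {α : Type*} {k l : Perm α} (z : α) (hz : l z = z) :
    k z = ((k * l) ^ (1 : ℤ)) z := by simp [hz]

theorem uniq_l {α : Type*} {k l : Perm α} (hk : k * k = 1) (hl : l * l = 1) (hG : Good k l)
    (z : α) (i : ℤ) (hz : l z = z) (hz' : l (((k * l) ^ i) z) = ((k * l) ^ i) z) :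
    ((k * l) ^ i) z = z := by
  obtain ⟨m, hm⟩ := hG z (Or.inr hz)
  refine uniq_aux _ _ i m ?_ hm
  rw [lz hk hl, kfix_of_l z hz, zadd, eq_comm, zeq] at hz'
  convert hz' using 3; ring

theorem comm_zpow {α : Type*} {k l σ : Perm α} (h1 : ∀ x, k (σ x) = σ (k x))
    (h2 : ∀ x, l (σ x) = σ (l x)) (i : ℤ) (x : α) :
    ((k * l) ^ i) (σ x) = σ (((k * l) ^ i) x) := by
  have : Commute (k * l) σ := by
    ext x; simp [h1, h2]
  exact congrArg (fun f : Perm α => f x) (this.zpow_left i).eq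

theorem fix_iff {α : Type*} {k σ : Perm α} (h1 : ∀ x, k (σ x) = σ (k x)) (x : α) :
    k (σ x) = σ x ↔ k x = x := by
  rw [h1, σ.injective.eq_iff]

theorem good_sign {k l σ : Perm (Fin N)} (hk : k * k = 1) (hl : l * l = 1) (hG : Good k l)
    (h1 : ∀ x, k (σ x) = σ (k x)) (h2 : ∀ x, l (σ x) = σ (l x)) :
    Ssign σ k = Ssign σ l := by
  rw [Ssign_comm σ k hk h1 (fix_iff h1), Ssign_comm σ l hl h2 (fix_iff h2)]
  congr 2
  have hex : ∀ x : {x // k x = x}, ∃ z : {z // l z = z}, ∃ i : ℤ, ((k * l) ^ i) x.1 = z.1 := by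
    rintro ⟨x, hx⟩
    obtain ⟨m, hm⟩ := hG x (Or.inl hx)
    refine ⟨⟨((k * l) ^ m) x, ?_⟩, m, rfl⟩
    rw [lz hk hl, hx, eq_comm, zeq]
    convert hm using 3; ring
  choose f hf using hex
  have hu : ∀ z z' : {z // l z = z}, (∃ i : ℤ, ((k * l) ^ i) z.1 = z'.1) → z = z' := by
    rintro ⟨z, hz⟩ ⟨z', hz'⟩ ⟨i, hi⟩
    simp only at hi
    subst hi
    exact Subtype.ext (uniq_l hk hl hG z i hz hz').symm
  have hbij : Function.Bijective f := by
    constructor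
    · rintro ⟨x, hx⟩ ⟨x', hx'⟩ he
      obtain ⟨i, hi⟩ := hf ⟨x, hx⟩
      obtain ⟨i', hi'⟩ := hf ⟨x', hx'⟩
      rw [he, ← hi'] at hi
      simp only at hi
      have h3 : ((k * l) ^ (-i' + i)) x = x' := by rw [← zadd, hi, zadd]; simp
      apply Subtype.ext
      simp only
      rw [← h3]
      refine (uniq_k hk hl hG x _ hx ?_).symm
      rw [h3, hx']
    · rintro ⟨z, hz⟩
      obtain ⟨m, hm⟩ := hG z (Or.inr hz)
      have hx : k (((k * l) ^ (m + 1)) z) = ((k * l) ^ (m + 1)) z := by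
        rw [kz hk hl, kfix_of_l z hz, zadd, eq_comm, zeq]
        convert hm using 3; ring
      refine ⟨⟨_, hx⟩, ?_⟩
      symm
      apply hu
      obtain ⟨i, hi⟩ := hf ⟨_, hx⟩
      rw [zadd] at hi
      exact ⟨_, hi⟩
  refine Perm.sign_eq_sign_of_equiv _ _ (Equiv.ofBijective f hbij) ?_
  intro x
  simp only [Equiv.ofBijective_apply]
  apply hu
  obtain ⟨i, hi⟩ := hf x
  obtain ⟨i', hi'⟩ := hf (σ.subtypePerm (fix_iff h1) x)
  refine ⟨i + -i', ?_⟩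
  rw [← hi', zadd]
  simp only [Perm.subtypePerm_apply]
  rw [comm_zpow h1 h2, ← hi]
  congr 3; ring

theorem bad_aux {k l : Perm (Fin N)} (hk : k * k = 1) (hl : l * l = 1) (x : Fin N)
    (hx : k x = x) (hb : ∀ m : ℤ, ((k * l) ^ (2 * m + 1)) x ≠ x) :
    ∃ σ : Perm (Fin N), (∀ x, k (σ x) = σ (k x)) ∧ (∀ x, l (σ x) = σ (l x)) ∧
      Ssign σ k = - Ssign σ l := by
  classical
  obtain ⟨d, hd⟩ : ∃ d, d = MulAction.period (k * l) x := ⟨_, rfl⟩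
  have hd0 : 0 < d := by
    rw [hd]; exact MulAction.period_pos_of_orderOf_pos (orderOf_pos _) _
  have hper : ∀ i : ℤ, ((k * l) ^ i) x = x ↔ (d : ℤ) ∣ i := by
    intro i; rw [hd]; exact zper _ _ _
  obtain ⟨m, rfl⟩ : ∃ m, d = 2 * m := by
    rcases Nat.even_or_odd' d with ⟨m, h | h⟩
    · exact ⟨m, h⟩
    · exfalso
      apply hb m
      rw [hper, h]; push_cast; exact dvd_refl _
  have hm0 : 0 < m := by omega
  let P : Fin N → Prop := fun z => ∃ i : ℤ, ((k * l) ^ i) x = z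
  have hPz : ∀ i : ℤ, P (((k * l) ^ i) x) := fun i => ⟨i, rfl⟩
  have hkz : ∀ i : ℤ, k (((k * l) ^ i) x) = ((k * l) ^ (-i)) x := by
    intro i; rw [kz hk hl, hx]
  have hlz : ∀ i : ℤ, l (((k * l) ^ i) x) = ((k * l) ^ (-i - 1)) x := by
    intro i; rw [lz hk hl, hx]
  have hPk : ∀ z, P (k z) ↔ P z := by
    have h0 : ∀ z, P z → P (k z) := by
      rintro z ⟨i, rfl⟩; rw [hkz]; exact hPz _
    intro z
    refine ⟨fun h => ?_, h0 z⟩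
    rw [← kk hk z]; exact h0 _ h
  have hPl : ∀ z, P (l z) ↔ P z := by
    have h0 : ∀ z, P z → P (l z) := by
      rintro z ⟨i, rfl⟩; rw [hlz]; exact hPz _
    intro z
    refine ⟨fun h => ?_, h0 z⟩
    rw [← kk hl z]; exact h0 _ h
  let s : Fin N → Fin N := fun z => if P z then ((k * l) ^ (m : ℤ)) z else z
  have hs1 : ∀ i : ℤ, s (((k * l) ^ i) x) = ((k * l) ^ (m + i)) x := by
    intro i; simp only [s, if_pos (hPz i)]; rw [zadd]
  have hs2 : ∀ z, ¬ P z → s z = z := by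
    intro z hz; simp only [s, if_neg hz]
  have hinv : Function.Involutive s := by
    intro z
    by_cases hz : P z
    · obtain ⟨i, rfl⟩ := hz
      rw [hs1, hs1, zeq, hper]
      exact ⟨1, by push_cast; ring⟩
    · rw [hs2 z hz, hs2 z hz]
  let σ : Perm (Fin N) := hinv.toPerm s
  have hσ : ∀ z, σ z = s z := fun z => rfl
  have c1 : ∀ z, k (σ z) = σ (k z) := by
    intro z
    rw [hσ, hσ]
    by_cases hz : P z
    · obtain ⟨i, rfl⟩ := hz
      rw [hs1, hkz, hkz, hs1, zeq, hper]
      exact ⟨-1, by push_cast; ring⟩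
    · rw [hs2 z hz, hs2 (k z) (by rwa [hPk])]
  have c2 : ∀ z, l (σ z) = σ (l z) := by
    intro z
    rw [hσ, hσ]
    by_cases hz : P z
    · obtain ⟨i, rfl⟩ := hz
      rw [hs1, hlz, hlz, hs1, zeq, hper]
      exact ⟨-1, by push_cast; ring⟩
    · rw [hs2 z hz, hs2 (l z) (by rwa [hPl])]
  refine ⟨σ, c1, c2, ?_⟩
  rw [Ssign_comm σ k hk c1 (fix_iff c1), Ssign_comm σ l hl c2 (fix_iff c2)]
  have e2 : σ.subtypePerm (p := fun x => l x = x) (fix_iff c2) = 1 := by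
    ext ⟨z, hz⟩
    simp only [Perm.subtypePerm_apply, Perm.one_apply]
    rw [hσ]
    congr 1
    apply hs2
    rintro ⟨i, rfl⟩
    rw [hlz, zeq] at hz
    apply hb (-i - 1)
    convert hz using 3; ring
  have hsx : σ x = ((k * l) ^ (m : ℤ)) x := by
    have := hs1 0
    simpa [hσ] using this
  have hne : x ≠ σ x := by
    rw [hsx, ne_comm, Ne, hper]
    rintro ⟨c, hc⟩
    push_cast at hc
    have h3 : (m : ℤ) * (2 * c - 1) = 0 := by linear_combination -hc
    rcases mul_eq_zero.1 h3 with h | h <;> omega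
  have hkx : k (σ x) = σ x := by rw [c1, hx]
  have e1 : σ.subtypePerm (p := fun x => k x = x) (fix_iff c1) =
      Equiv.swap ⟨x, hx⟩ ⟨σ x, hkx⟩ := by
    apply Equiv.ext
    rintro ⟨z, hz⟩
    by_cases hzx : z = x
    · subst hzx
      rw [Equiv.swap_apply_left]; rfl
    by_cases hzx' : z = σ x
    · subst hzx'
      rw [Equiv.swap_apply_right]
      apply Subtype.ext
      exact hinv x
    rw [Equiv.swap_apply_of_ne_of_ne (by simpa using hzx) (by simpa using hzx')]
    apply Subtype.ext
    simp only [Perm.subtypePerm_apply]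
    rw [hσ]
    apply hs2
    rintro ⟨i, rfl⟩
    rw [hkz, eq_comm, zeq, hper] at hz
    obtain ⟨c, hc⟩ := hz
    have hi : i = m * c := by
      push_cast at hc
      have : 2 * (i - m * c) = 0 := by linear_combination hc
      omega
    rcases Int.even_or_odd' c with ⟨a, ha | ha⟩
    · apply hzx
      rw [hper, hi, ha]
      exact ⟨a, by push_cast; ring⟩
    · apply hzx'
      rw [hsx, zeq, hper, hi, ha]
      exact ⟨a, by push_cast; ring⟩
  rw [e1, e2, Perm.sign_swap (by simpa using hne)]
  simp

theorem bad_sign {k l : Perm (Fin N)} (hk : k * k = 1) (hl : l * l = 1) (hG : ¬ Good k l) :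
    ∃ σ : Perm (Fin N), (∀ x, k (σ x) = σ (k x)) ∧ (∀ x, l (σ x) = σ (l x)) ∧
      Ssign σ k = - Ssign σ l := by
  unfold Good at hG
  push Not at hG
  obtain ⟨x, hx | hx, hb⟩ := hG
  · exact bad_aux hk hl x hx hb
  · obtain ⟨σ, h1, h2, h3⟩ := bad_aux hl hk x hx (by
      intro m hm
      apply hb (-m - 1)
      have h4 : l * k = (k * l)⁻¹ := by
        rw [mul_inv_rev, inv_eq_of_mul_eq_one_left hk, inv_eq_of_mul_eq_one_left hl]
      rw [h4, inv_zpow, ← zpow_neg] at hm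
      convert hm using 3; ring)
    exact ⟨σ, h2, h1, by rw [h3]; simp⟩

end Stab

section Models
variable {α β γ : Type*}

theorem map_zp (f : α → β) (r : Perm α) (r' : Perm β) (h : ∀ x, f (r x) = r' (f x)) (i : ℤ) :
    ∀ x, f ((r ^ i) x) = (r' ^ i) (f x) := by
  induction i using Int.induction_on with
  | zero => intro x; simp
  | succ i ih => intro x; rw [zpow_add_one, zpow_add_one, Perm.mul_apply, ih, h]; rfl
  | pred i ih =>
    intro x
    rw [zpow_sub_one, zpow_sub_one, Perm.mul_apply, ih, Perm.mul_apply]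
    congr 1
    apply r'.injective
    rw [← h]; simp

/-- equivariant map between pairs -/
def Intw (f : α → β) (k l : Perm α) (k' l' : Perm β) : Prop :=
  (∀ x, f (k x) = k' (f x)) ∧ (∀ x, f (l x) = l' (f x))

theorem Intw.z {f : α → β} {k l : Perm α} {k' l' : Perm β} (h : Intw f k l k' l') (i : ℤ) (x : α) :
    f (((k * l) ^ i) x) = ((k' * l') ^ i) (f x) :=
  map_zp f _ _ (by intro x; simp [h.1, h.2]) i x

theorem Intw.w {f : α → β} {k l : Perm α} {k' l' : Perm β} (h : Intw f k l k' l')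
    (g : ℤ × Bool) (x : α) : f (wpt k l x g) = wpt k' l' (f x) g := by
  obtain ⟨i, b⟩ := g
  cases b <;> simp [wpt, h.z, h.1]

theorem Intw.comp {f : α → β} {g : β → γ} {k l : Perm α} {k' l' : Perm β} {k'' l'' : Perm γ}
    (h : Intw f k l k' l') (h' : Intw g k' l' k'' l'') : Intw (fun x => g (f x)) k l k'' l'' :=
  ⟨fun x => by show g (f (k x)) = k'' (g (f x)); rw [h.1, h'.1],
    fun x => by show g (f (l x)) = l'' (g (f x)); rw [h.2, h'.2]⟩

theorem Intw.symm {f : α ≃ β} {k l : Perm α} {k' l' : Perm β}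
    (h : Intw f k l k' l') : Intw f.symm k' l' k l :=
  ⟨fun x => by rw [Equiv.symm_apply_eq, h.1]; simp, fun x => by rw [Equiv.symm_apply_eq, h.2]; simp⟩

theorem Intw.sq_k {f : α ≃ β} {k l : Perm α} {k' l' : Perm β}
    (h : Intw f k l k' l') (hk : k' * k' = 1) : k * k = 1 := by
  ext x; apply f.injective; simp [h.1, kk hk]

theorem Intw.sq_l {f : α ≃ β} {k l : Perm α} {k' l' : Perm β}
    (h : Intw f k l k' l') (hk : l' * l' = 1) : l * l = 1 := by
  ext x; apply f.injective; simp [h.2, kk hk]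

theorem Intw.good_back {f : α → β} (hf : Function.Injective f) {k l : Perm α} {k' l' : Perm β}
    (h : Intw f k l k' l') (hG : Good k' l') : Good k l := by
  intro x hx
  obtain ⟨m, hm⟩ := hG (f x) (by
    rcases hx with hx | hx
    · left; rw [← h.1, hx]
    · right; rw [← h.2, hx])
  exact ⟨m, hf (by rw [h.z, hm])⟩

theorem Intw.trans_back {f : α → β} (hf : Function.Injective f) {k l : Perm α} {k' l' : Perm β}
    (h : Intw f k l k' l') (hT : ∀ x z, OrbRel k' l' (f x) (f z)) : Trans2 k l := by
  intro x z
  obtain ⟨g, hg⟩ := hT x z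
  exact ⟨g, hf (by rw [h.w, hg])⟩

theorem fix_card {f : α ≃ β} {k : Perm α} {k' : Perm β} (h : ∀ x, f (k x) = k' (f x)) :
    Nat.card {x // k x = x} = Nat.card {x // k' x = x} :=
  Nat.card_congr (f.subtypeEquiv (fun x => by rw [← h, f.injective.eq_iff]))

/-- properties of the model pairs -/
def IsMod (k l : Perm α) : Prop :=
  k * k = 1 ∧ l * l = 1 ∧ Trans2 k l ∧ Good k l ∧
    Nat.card {x // k x = x} = Nat.card α % 2 ∧ Nat.card {x // l x = x} = Nat.card α % 2

theorem IsMod.transport {k l : Perm α} (h : IsMod k l) (e : β ≃ α) :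
    ∃ k' l' : Perm β, IsMod k' l' := by
  have hi : Intw e (e.permCongr.symm k) (e.permCongr.symm l) k l :=
    ⟨fun x => by simp, fun x => by simp⟩
  obtain ⟨h1, h2, h3, h4, h5, h6⟩ := h
  refine ⟨_, _, hi.sq_k h1, hi.sq_l h2, hi.trans_back e.injective (fun _ _ => h3 _ _),
    hi.good_back e.injective h4, ?_, ?_⟩
  · rw [fix_card hi.1, h5, Nat.card_congr e]
  · rw [fix_card hi.2, h6, Nat.card_congr e]

theorem mod_odd (m : ℕ) : IsMod (Equiv.subLeft (0 : ZMod (2 * m + 1))) (Equiv.subLeft 1) := by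
  have hr : ∀ x : ZMod (2 * m + 1),
      ((Equiv.subLeft (0 : ZMod (2 * m + 1))) * (Equiv.subLeft 1) : Perm _) x =
        Equiv.subRight 1 x := by
    intro x; simp
  have hz : ∀ (i : ℤ) (x : ZMod (2 * m + 1)),
      (((Equiv.subLeft (0 : ZMod (2 * m + 1))) * (Equiv.subLeft 1) : Perm _) ^ i) x = x - i := by
    intro i
    induction i using Int.induction_on with
    | zero => intro x; simp
    | succ i ih => intro x; rw [zpow_add_one, Perm.mul_apply, ih, hr]; simp; ring
    | pred i ih =>
      intro x
      apply Equiv.injective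
        ((Equiv.subLeft (0 : ZMod (2 * m + 1))) * (Equiv.subLeft 1) : Perm (ZMod (2 * m + 1)))
      rw [← Perm.mul_apply, ← zpow_one_add, hr]
      have : (1 + (-(i : ℤ) - 1)) = -i := by ring
      rw [this, ih]; simp; ring
  have hn : (2 : ZMod (2 * m + 1)) * m + 1 = 0 := by
    have := ZMod.natCast_self (2 * m + 1)
    push_cast at this; exact this
  refine ⟨?_, ?_, ?_, ?_, ?_, ?_⟩
  · ext x; simp
  · ext x; simp
  · intro x z
    obtain ⟨i, hi⟩ := ZMod.intCast_surjective (x - z)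
    refine ⟨(i, false), ?_⟩
    simp only [wpt, hz, hi]; simp
  · intro x _
    refine ⟨m, ?_⟩
    rw [hz]; push_cast; rw [hn]; simp
  · have : Nat.card (ZMod (2 * m + 1)) % 2 = 1 := by simp
    rw [this, Nat.card_eq_one_iff_exists]
    refine ⟨⟨0, by simp⟩, ?_⟩
    rintro ⟨x, hx⟩
    apply Subtype.ext
    simp only [Equiv.subLeft_apply] at hx
    simp only
    linear_combination (m : ZMod (2 * m + 1)) * hx + x * hn
  · have : Nat.card (ZMod (2 * m + 1)) % 2 = 1 := by simp
    rw [this, Nat.card_eq_one_iff_exists]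
    refine ⟨⟨-m, by simp only [Equiv.subLeft_apply]; linear_combination hn⟩, ?_⟩
    rintro ⟨x, hx⟩
    apply Subtype.ext
    simp only [Equiv.subLeft_apply] at hx
    simp only
    linear_combination (m : ZMod (2 * m + 1)) * hx + x * hn

theorem mod_even (c : ℕ) (hc : 0 < c) :
    IsMod (Equiv.prodCongr (Equiv.subLeft (0 : ZMod c)) Equiv.boolNot)
      (Equiv.prodCongr (Equiv.subLeft (1 : ZMod c)) Equiv.boolNot) := by
  set k : Perm (ZMod c × Bool) := Equiv.prodCongr (Equiv.subLeft (0 : ZMod c)) Equiv.boolNot with hk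
  set l : Perm (ZMod c × Bool) := Equiv.prodCongr (Equiv.subLeft (1 : ZMod c)) Equiv.boolNot with hl
  have hr : ∀ x, (k * l) x = (x.1 - 1, x.2) := by
    intro x; simp [hk, hl, Prod.ext_iff]
  have hz : ∀ (i : ℤ) x, ((k * l) ^ i) x = (x.1 - i, x.2) := by
    intro i
    induction i using Int.induction_on with
    | zero => intro x; simp
    | succ i ih => intro x; rw [zpow_add_one, Perm.mul_apply, ih, hr]; simp; ring
    | pred i ih =>
      intro x
      apply Equiv.injective (k * l)
      rw [← Perm.mul_apply, ← zpow_one_add, hr]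
      have : (1 + (-(i : ℤ) - 1)) = -i := by ring
      rw [this, ih]; simp; ring
  have fk : ∀ x, k x ≠ x := by
    rintro ⟨x, b⟩; cases b <;> simp [hk]
  have fl : ∀ x, l x ≠ x := by
    rintro ⟨x, b⟩; cases b <;> simp [hl]
  have hcard : Nat.card (ZMod c × Bool) % 2 = 0 := by simp [Nat.card_prod]
  refine ⟨?_, ?_, ?_, ?_, ?_, ?_⟩
  · apply Equiv.ext; rintro ⟨x, b⟩; simp [hk]
  · apply Equiv.ext; rintro ⟨x, b⟩; simp [hl]
  · rintro ⟨x, b⟩ ⟨z, b'⟩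
    by_cases hb : b = b'
    · subst hb
      obtain ⟨i, hi⟩ := ZMod.intCast_surjective (x - z)
      refine ⟨(i, false), ?_⟩
      simp [wpt, hz, hi]
    · have hb' : (!b) = b' := by cases b <;> cases b' <;> simp_all
      obtain ⟨i, hi⟩ := ZMod.intCast_surjective (- x - z)
      refine ⟨(i, true), ?_⟩
      have hkx : k (x, b) = (-x, b') := by simp [hk, hb']
      show ((k * l) ^ i) (k (x, b)) = _
      rw [hkx, hz]; simp [hi]
  · intro x hx
    rcases hx with hx | hx
    · exact absurd hx (fk x)
    · exact absurd hx (fl x)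
  · rw [hcard]
    have : IsEmpty {x // k x = x} := ⟨fun x => fk _ x.2⟩
    exact Nat.card_of_isEmpty
  · rw [hcard]
    have : IsEmpty {x // l x = x} := ⟨fun x => fl _ x.2⟩
    exact Nat.card_of_isEmpty

theorem mod_exists (n : ℕ) : ∃ kl : Perm (Fin n) × Perm (Fin n), IsMod kl.1 kl.2 := by
  rcases Nat.eq_zero_or_pos n with rfl | hn
  · refine ⟨(1, 1), by simp, by simp, fun x => x.elim0, fun x => x.elim0, ?_, ?_⟩ <;> simp
  suffices h : ∃ k l : Perm (Fin n), IsMod k l by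
    obtain ⟨k, l, h⟩ := h; exact ⟨(k, l), h⟩
  rcases Nat.even_or_odd' n with ⟨m, rfl | rfl⟩
  · have hm : 0 < m := by omega
    have : NeZero m := ⟨by omega⟩
    refine (mod_even m hm).transport (Fintype.equivOfCardEq ?_)
    simp [ZMod.card]; ring
  · refine (mod_odd m).transport (Fintype.equivOfCardEq ?_)
    simp [ZMod.card]

/-- the model pair on `Fin n` -/
noncomputable def modP (n : ℕ) : Perm (Fin n) × Perm (Fin n) := (mod_exists n).choose

theorem modP_spec (n : ℕ) : IsMod (modP n).1 (modP n).2 := (mod_exists n).choose_spec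

end Models

section Types

/-- direct sum of model pairs, first involution -/
noncomputable def KS {ι : Type*} (c : ι → ℕ) : Perm (Σ i, Fin (c i)) :=
  Equiv.sigmaCongrRight (fun i => (modP (c i)).1)

/-- direct sum of model pairs, second involution -/
noncomputable def LS {ι : Type*} (c : ι → ℕ) : Perm (Σ i, Fin (c i)) :=
  Equiv.sigmaCongrRight (fun i => (modP (c i)).2)

variable {ι ι' : Type*} (c : ι → ℕ)

theorem intw_mk (i : ι) :
    Intw (fun x : Fin (c i) => (⟨i, x⟩ : Σ i, Fin (c i))) (modP (c i)).1 (modP (c i)).2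
      (KS c) (LS c) :=
  ⟨fun _ => rfl, fun _ => rfl⟩

theorem KS_sq : KS c * KS c = 1 := by
  apply Equiv.ext; rintro ⟨i, x⟩
  have := (intw_mk c i).1
  simp only [Perm.mul_apply, ← this, kk (modP_spec (c i)).1]; rfl

theorem LS_sq : LS c * LS c = 1 := by
  apply Equiv.ext; rintro ⟨i, x⟩
  have := (intw_mk c i).2
  simp only [Perm.mul_apply, ← this, kk (modP_spec (c i)).2.1]; rfl

theorem S_good : Good (KS c) (LS c) := by
  rintro ⟨i, x⟩ hx
  have hI := intw_mk c i
  obtain ⟨m, hm⟩ := (modP_spec (c i)).2.2.2.1 x (by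
    rcases hx with hx | hx
    · left
      rw [← hI.1] at hx
      simpa using hx
    · right
      rw [← hI.2] at hx
      simpa using hx)
  refine ⟨m, ?_⟩
  have := hI.z (2 * m + 1) x
  rw [hm] at this
  exact this.symm

theorem S_orb (v w : Σ i, Fin (c i)) : OrbRel (KS c) (LS c) v w ↔ w.1 = v.1 := by
  obtain ⟨i, x⟩ := v
  have hI := intw_mk c i
  constructor
  · rintro ⟨g, rfl⟩
    rw [← hI.w]
  · obtain ⟨i', y⟩ := w
    rintro h
    simp only at h
    subst h
    obtain ⟨g, hg⟩ := (modP_spec (c i')).2.2.1 x y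
    refine ⟨g, ?_⟩
    rw [← (intw_mk c i').w, hg]

theorem S_fix [Fintype ι] (f : ∀ i, Perm (Fin (c i)))
    (h : ∀ i, Nat.card {x // f i x = x} = c i % 2) :
    Nat.card {x // (Equiv.sigmaCongrRight f) x = x} =
      ((univ.val.map c).filter (fun x => Odd x)).card := by
  have e : {x // (Equiv.sigmaCongrRight f) x = x} ≃ Σ i, {x // f i x = x} :=
    { toFun := fun x => ⟨x.1.1, x.1.2, by
        obtain ⟨⟨i, x⟩, hx⟩ := x
        simpa using hx⟩
      invFun := fun x => ⟨⟨x.1, x.2.1⟩, by simp [x.2.2]⟩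
      left_inv := fun x => rfl
      right_inv := fun x => rfl }
  rw [Nat.card_congr e, Nat.card_sigma]
  simp only [h]
  rw [Multiset.filter_map, Multiset.card_map]
  have : (Multiset.filter ((fun x => Odd x) ∘ c) univ.val).card
      = (univ.filter (fun i => Odd (c i))).card := rfl
  rw [this, Finset.card_filter]
  apply Finset.sum_congr rfl
  intro i _
  split_ifs with hi
  · exact Nat.odd_iff.1 hi
  · exact Nat.even_iff.1 (Nat.not_odd_iff_even.1 hi)

theorem count_fiber [Fintype ι] (n : ℕ) :
    Nat.card {i // c i = n} = (univ.val.map c).count n := by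
  classical
  rw [Multiset.count_map, Nat.card_eq_fintype_card, Fintype.card_subtype]
  simp only [eq_comm (a := n)]
  rfl

theorem reindex [Fintype ι] [Fintype ι'] (c : ι → ℕ) (c' : ι' → ℕ)
    (h : (univ.val.map c) = univ.val.map c') : ∃ r : ι ≃ ι', ∀ i, c' (r i) = c i := by
  have h1 : ∀ n, Nonempty ({i // c i = n} ≃ {i // c' i = n}) := by
    intro n
    have := (count_fiber c n).trans ((congrArg _ h).trans (count_fiber c' n).symm)
    exact Finite.card_eq.1 this
  let E := fun n => (h1 n).some
  refine ⟨(Equiv.sigmaFiberEquiv c).symm.trans ((Equiv.sigmaCongrRight E).trans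
    (Equiv.sigmaFiberEquiv c')), fun i => ?_⟩
  exact (E (c i) ⟨i, rfl⟩).2

theorem S_iso [Fintype ι] [Fintype ι'] (c : ι → ℕ) (c' : ι' → ℕ)
    (h : (univ.val.map c) = univ.val.map c') :
    ∃ e : (Σ i, Fin (c i)) ≃ Σ i, Fin (c' i), Intw e (KS c) (LS c) (KS c') (LS c') := by
  obtain ⟨r, hr⟩ := reindex c c' h
  obtain rfl : c = fun i => c' (r i) := funext fun i => (hr i).symm
  exact ⟨Equiv.sigmaCongrLeft (β := fun i => Fin (c' i)) r, fun _ => rfl, fun _ => rfl⟩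

variable {N : ℕ}

/-- The pair `(k, l)` has type `p`. -/
def HasType (k l : Perm (Fin N)) (p : N.Partition) : Prop :=
  ∃ (ι : Type) (_ : Fintype ι) (c : ι → ℕ) (e : Fin N ≃ Σ i, Fin (c i)),
    univ.val.map c = p.parts ∧ Intw e k l (KS c) (LS c)

theorem HasType.conj {k l k' l' : Perm (Fin N)} {p : N.Partition} (h : HasType k l p)
    (σ : Perm (Fin N)) (hs : Intw σ k' l' k l) : HasType k' l' p := by
  obtain ⟨ι, _, c, e, h1, h2⟩ := h
  exact ⟨ι, inferInstance, c, σ.trans e, h1, hs.comp h2⟩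

theorem HasType.iso {k l k' l' : Perm (Fin N)} {p : N.Partition} (h : HasType k l p)
    (h' : HasType k' l' p) : ∃ σ : Perm (Fin N), Intw σ k l k' l' := by
  obtain ⟨ι, _, c, e, h1, h2⟩ := h
  obtain ⟨ι', _, c', e', h1', h2'⟩ := h'
  obtain ⟨r, hr⟩ := S_iso c c' (h1.trans h1'.symm)
  exact ⟨(e.trans r).trans e'.symm, (h2.comp hr).comp h2'.symm⟩

theorem HasType.exists_pair (p : N.Partition) : ∃ k l : Perm (Fin N), HasType k l p := by
  have hp : (univ.val.map (fun i : p.parts.ToType => i.1)) = p.parts := by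
    simp
  have hc : Fintype.card (Fin N) = Fintype.card (Σ i : p.parts.ToType, Fin i.1) := by
    rw [Fintype.card_sigma]
    simp only [Fintype.card_fin]
    have : (∑ i : p.parts.ToType, i.1) = p.parts.sum := by
      rw [Finset.sum, hp]
    rw [this, p.parts_sum]
  let e := Fintype.equivOfCardEq hc
  exact ⟨e.permCongr.symm (KS _), e.permCongr.symm (LS _), p.parts.ToType, inferInstance, _, e, hp,
    fun x => by simp, fun x => by simp⟩

theorem HasType.good {k l : Perm (Fin N)} {p : N.Partition} (h : HasType k l p) :
    k * k = 1 ∧ l * l = 1 ∧ Good k l ∧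
      Nat.card {x // k x = x} = (p.parts.filter (fun x => Odd x)).card ∧
      Nat.card {x // l x = x} = (p.parts.filter (fun x => Odd x)).card := by
  obtain ⟨ι, _, c, e, h1, h2⟩ := h
  refine ⟨h2.sq_k (KS_sq c), h2.sq_l (LS_sq c), h2.good_back e.injective (S_good c), ?_, ?_⟩
  · rw [fix_card h2.1, ← h1]
    exact S_fix c _ (fun i => by simpa using (modP_spec (c i)).2.2.2.2.1)
  · rw [fix_card h2.2, ← h1]
    exact S_fix c _ (fun i => by simpa using (modP_spec (c i)).2.2.2.2.2)

theorem HasType.count {k l : Perm (Fin N)} {p : N.Partition} (h : HasType k l p) (n : ℕ) :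
    Nat.card {x // Nat.card {z // OrbRel k l x z} = n} = p.parts.count n * n := by
  obtain ⟨ι, _, c, e, h1, h2⟩ := h
  have ho : ∀ x z, OrbRel k l x z ↔ (e z).1 = (e x).1 := by
    intro x z
    rw [← S_orb]
    constructor
    · rintro ⟨g, rfl⟩; exact ⟨g, (h2.w g x).symm⟩
    · rintro ⟨g, hg⟩; exact ⟨g, e.injective (by rw [h2.w, hg])⟩
  have hc : ∀ x, Nat.card {z // OrbRel k l x z} = c (e x).1 := by
    intro x
    have e1 : {z // OrbRel k l x z} ≃ {w : Σ i, Fin (c i) // w.1 = (e x).1} :=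
      e.subtypeEquiv (fun z => ho x z)
    have e2 : {w : Σ i, Fin (c i) // w.1 = (e x).1} ≃ Fin (c (e x).1) :=
      Equiv.sigmaSubtype (β := fun i => Fin (c i)) (e x).1
    rw [Nat.card_congr (e1.trans e2)]; simp
  simp only [hc]
  have e1 : {x // c (e x).1 = n} ≃ {w : Σ i, Fin (c i) // c w.1 = n} :=
    e.subtypeEquiv (fun z => Iff.rfl)
  have e2 : {w : Σ i, Fin (c i) // c w.1 = n} ≃ Σ i : {i // c i = n}, Fin (c i) :=
    { toFun := fun w => ⟨⟨w.1.1, w.2⟩, w.1.2⟩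
      invFun := fun w => ⟨⟨w.1.1, w.2⟩, w.1.2⟩
      left_inv := fun w => rfl
      right_inv := fun w => rfl }
  rw [Nat.card_congr (e1.trans e2), ← h1, ← count_fiber, Nat.card_sigma,
    Nat.card_eq_fintype_card]
  rw [Finset.sum_congr rfl (fun i _ => show Nat.card (Fin (c i.1)) = n by simp [i.2])]
  simp

theorem HasType.unique {k l : Perm (Fin N)} {p p' : N.Partition} (h : HasType k l p)
    (h' : HasType k l p') : p = p' := by
  apply Nat.Partition.ext
  ext n
  have := (h.count n).symm.trans (h'.count n)
  rcases Nat.eq_zero_or_pos n with rfl | hn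
  · rw [Multiset.count_eq_zero_of_notMem, Multiset.count_eq_zero_of_notMem]
    · intro h0; exact absurd (p'.parts_pos h0) (lt_irrefl _)
    · intro h0; exact absurd (p.parts_pos h0) (lt_irrefl _)
  · exact Nat.eq_of_mul_eq_mul_right hn this

theorem HasType.exists_type {k l : Perm (Fin N)} (hk : k * k = 1) (hl : l * l = 1)
    (hG : Good k l) : ∃ p, HasType k l p := by
  classical
  let s : Setoid (Fin N) := ⟨OrbRel k l, fun x => OrbRel.refl k l x,
    fun h => OrbRel.symm hk hl h, fun h h' => OrbRel.trans hk hl h h'⟩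
  let q : Fin N → Quotient s := Quotient.mk s
  have qe : ∀ x z, q x = q z ↔ OrbRel k l x z := fun x z => Quotient.eq (r := s)
  have qk : ∀ x, q (k x) = q x := fun x => ((qe _ _).2 (OrbRel.k hk hl (OrbRel.refl k l x))).symm
  have ql : ∀ x, q (l x) = q x := fun x => ((qe _ _).2 (OrbRel.l hk hl (OrbRel.refl k l x))).symm
  let c : Quotient s → ℕ := fun a => Fintype.card {x // q x = a}
  let kf : ∀ a, Perm {x // q x = a} := fun a => k.subtypePerm (fun x => by rw [qk])
  let lf : ∀ a, Perm {x // q x = a} := fun a => l.subtypePerm (fun x => by rw [ql])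
  have hI : ∀ a, Intw (fun x : {x // q x = a} => x.1) (kf a) (lf a) k l :=
    fun a => ⟨fun _ => rfl, fun _ => rfl⟩
  have hex : ∀ a, ∃ e : {x // q x = a} ≃ Fin (c a),
      Intw e (kf a) (lf a) (modP (c a)).1 (modP (c a)).2 := by
    intro a
    obtain ⟨x0, hx0⟩ := Quotient.exists_rep a
    have : Nonempty {x // q x = a} := ⟨⟨x0, hx0⟩⟩
    obtain ⟨m1, m2, m3, m4, _⟩ := modP_spec (c a)
    refine iso_of_trans ?_ ?_ m1 m2 ?_ ?_ m3 m4 (by simp [c])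
    · ext x; simp [kf, kk hk]
    · ext x; simp [lf, kk hl]
    · refine (hI a).trans_back Subtype.val_injective ?_
      rintro ⟨x, rfl⟩ ⟨z, hz⟩
      exact (qe _ _).1 hz.symm
    · exact (hI a).good_back Subtype.val_injective hG
  choose E hE using hex
  let e : Fin N ≃ Σ a, Fin (c a) :=
    (Equiv.sigmaFiberEquiv q).symm.trans (Equiv.sigmaCongrRight E)
  have he : ∀ a (x : {x // q x = a}), e x.1 = ⟨a, E a x⟩ := by
    rintro a ⟨x, rfl⟩; rfl
  have hpos : ∀ {i}, i ∈ univ.val.map c → 0 < i := by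
    intro i hi
    obtain ⟨a, _, rfl⟩ := Multiset.mem_map.1 hi
    obtain ⟨x0, hx0⟩ := Quotient.exists_rep a
    exact Fintype.card_pos_iff.2 ⟨⟨x0, hx0⟩⟩
  have hsum : (univ.val.map c).sum = N := by
    have := Fintype.card_congr e
    rw [Fintype.card_sigma] at this
    simp only [Fintype.card_fin] at this
    exact this.symm
  refine ⟨⟨univ.val.map c, hpos, hsum⟩, Quotient s, inferInstance, c, e, rfl, ?_, ?_⟩
  · intro x
    have h1 := he (q x) ⟨x, rfl⟩
    have h2 := he (q x) (kf (q x) ⟨x, rfl⟩)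
    rw [(hE (q x)).1] at h2
    simp only at h1
    rw [h1]; exact h2
  · intro x
    have h1 := he (q x) ⟨x, rfl⟩
    have h2 := he (q x) (lf (q x) ⟨x, rfl⟩)
    rw [(hE (q x)).2] at h2
    simp only at h1
    rw [h1]; exact h2

theorem supp_fix (k : Perm (Fin N)) : k.support.card + Nat.card {x // k x = x} = N := by
  rw [Nat.card_eq_fintype_card, Fintype.card_subtype]
  have : k.support = univ.filter (fun x => ¬ k x = x) := by ext x; simp
  rw [this, add_comm, Finset.card_filter_add_card_filter_not]; simp

end Types

section Final
variable {N j : ℕ}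

theorem ivc_mul (σ ρ : Perm (Fin N)) (τ : InvolJ N j) :
    involConj (σ * ρ) τ = involConj σ (involConj ρ τ) := by
  apply Subtype.ext; simp [involConj, mul_assoc]

theorem ivc_one (τ : InvolJ N j) : involConj 1 τ = τ := by
  apply Subtype.ext; simp [involConj]

theorem ivc_inv (σ : Perm (Fin N)) (τ : InvolJ N j) : involConj σ⁻¹ (involConj σ τ) = τ := by
  rw [← ivc_mul, inv_mul_cancel, ivc_one]

theorem ivc_iff (σ : Perm (Fin N)) (τ τ' : InvolJ N j) :
    involConj σ τ = τ' ↔ ∀ x, σ (τ.1 x) = τ'.1 (σ x) := by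
  constructor
  · rintro rfl x; simp [involConj]
  · intro h
    apply Subtype.ext
    apply Equiv.ext
    intro x
    show σ (τ.1 (σ⁻¹ x)) = τ'.1 x
    rw [h]; simp

theorem intw_iff (σ : Perm (Fin N)) (κ τ κ' τ' : InvolJ N j) :
    Intw σ κ.1 τ.1 κ'.1 τ'.1 ↔ involConj σ κ = κ' ∧ involConj σ τ = τ' := by
  rw [ivc_iff, ivc_iff]; rfl

theorem sgn_mul (σ ρ : Perm (Fin N)) (τ : InvolJ N j) :
    (Ssign (σ * ρ) τ.1 : ℂ) = Ssign σ (involConj ρ τ).1 * Ssign ρ τ.1 := by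
  rw [Ssign_mul σ ρ τ.1 τ.2.1]; push_cast; rfl

theorem sgn_sq (σ : Perm (Fin N)) (τ : InvolJ N j) :
    (Ssign σ τ.1 : ℂ) * Ssign σ τ.1 = 1 := by
  exact_mod_cast Ssign_sq σ τ.1

theorem sgn_ne (σ : Perm (Fin N)) (τ : InvolJ N j) : (Ssign σ τ.1 : ℂ) ≠ 0 := by
  intro h
  have := sgn_sq σ τ
  rw [h] at this; simp at this

theorem mem_EndG (T : (InvolJ N j → ℂ) →ₗ[ℂ] (InvolJ N j → ℂ)) :
    T ∈ EndG N j ↔ ∀ (σ : Perm (Fin N)) (κ τ : InvolJ N j),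
      (Ssign σ τ.1 : ℂ) * T (Pi.single (involConj σ τ) 1) (involConj σ κ) =
        Ssign σ κ.1 * T (Pi.single τ 1) κ := by
  have key : ∀ (σ : Perm (Fin N)) (κ τ : InvolJ N j),
      (T (piRep N j σ (Pi.single τ 1)) (involConj σ κ) =
        (Ssign σ τ.1 : ℂ) * T (Pi.single (involConj σ τ) 1) (involConj σ κ)) ∧
      (piRep N j σ (T (Pi.single τ 1)) (involConj σ κ) =
        Ssign σ κ.1 * T (Pi.single τ 1) κ) := by
    intro σ κ τ
    constructor
    · rw [piRep_single, map_smul]; rfl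
    · simp only [piRep, LinearMap.coe_mk, AddHom.coe_mk]
      rw [ivc_inv]
  constructor
  · intro h σ κ τ
    rw [← (key σ κ τ).1, ← (key σ κ τ).2]
    have := LinearMap.congr_fun (h σ) (Pi.single τ 1)
    exact congrFun this _
  · intro h σ
    apply (Pi.basisFun ℂ (InvolJ N j)).ext
    intro τ
    rw [Pi.basisFun_apply]
    funext κ
    have := h σ (involConj σ⁻¹ κ) τ
    rw [← (key σ _ τ).1, ← (key σ _ τ).2, ← ivc_mul, mul_inv_cancel, ivc_one] at this
    exact this

/-- the index set of partitions -/
abbrev PP (N j : ℕ) : Type :=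
  {p : Nat.Partition N // (p.parts.filter fun x => Odd x).card = N - 2 * j}

theorem fix_InvolJ (τ : InvolJ N j) : Nat.card {x // τ.1 x = x} = N - 2 * j := by
  have := supp_fix τ.1
  rw [τ.2.2] at this; omega

theorem exists_y (hj : j ≤ N / 2) (p : PP N j) :
    ∃ y : InvolJ N j × InvolJ N j, HasType y.1.1 y.2.1 p.1 := by
  obtain ⟨k, l, h⟩ := HasType.exists_pair p.1
  obtain ⟨h1, h2, -, h3, h4⟩ := h.good
  rw [p.2] at h3 h4
  have hk := supp_fix k
  have hl := supp_fix l
  exact ⟨(⟨k, h1, by omega⟩, ⟨l, h2, by omega⟩), h⟩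

theorem exists_p (κ τ : InvolJ N j) (hG : Good κ.1 τ.1) : ∃ p : PP N j, HasType κ.1 τ.1 p.1 := by
  obtain ⟨p, hp⟩ := HasType.exists_type κ.2.1 τ.2.1 hG
  refine ⟨⟨p, ?_⟩, hp⟩
  rw [← hp.good.2.2.2.1, fix_InvolJ]

/-- evaluation of endomorphisms at the chosen pairs -/
noncomputable def evalMap (y : PP N j → InvolJ N j × InvolJ N j) : EndG N j →ₗ[ℂ] (PP N j → ℂ) where
  toFun T := fun p => T.1 (Pi.single (y p).2 1) (y p).1
  map_add' _ _ := rfl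
  map_smul' _ _ := rfl

theorem evalMap_inj (y : PP N j → InvolJ N j × InvolJ N j)
    (hy : ∀ p, HasType (y p).1.1 (y p).2.1 p.1) : Function.Injective (evalMap y) := by
  rintro ⟨T₁, hT₁⟩ ⟨T₂, hT₂⟩ h0
  obtain ⟨T, rfl⟩ : ∃ T, T₁ = T₂ + T := ⟨T₁ - T₂, by abel⟩
  have h0' : ∀ p, T (Pi.single (y p).2 1) (y p).1 = 0 := fun p => by
    have h1 : (T₂ + T) (Pi.single (y p).2 1) (y p).1 = T₂ (Pi.single (y p).2 1) (y p).1 :=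
      congrFun h0 p
    simpa using h1
  have hT' : ∀ (σ : Perm (Fin N)) (κ τ : InvolJ N j),
      (Ssign σ τ.1 : ℂ) * T (Pi.single (involConj σ τ) 1) (involConj σ κ) =
        Ssign σ κ.1 * T (Pi.single τ 1) κ := by
    intro σ κ τ
    have a := (mem_EndG _).1 hT₁ σ κ τ
    have b := (mem_EndG _).1 hT₂ σ κ τ
    simp only [LinearMap.add_apply, Pi.add_apply] at a
    linear_combination a - b
  apply Subtype.ext
  show T₂ + T = T₂
  suffices hz : T = 0 by rw [hz, add_zero]
  apply (Pi.basisFun ℂ (InvolJ N j)).ext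
  intro τ
  rw [Pi.basisFun_apply]
  funext κ
  show T (Pi.single τ 1) κ = 0
  by_cases hG : Good κ.1 τ.1
  · obtain ⟨p, hp⟩ := exists_p κ τ hG
    obtain ⟨σ, hσ⟩ := hp.iso (hy p)
    obtain ⟨h1, h2⟩ := (intw_iff _ _ _ _ _).1 hσ
    have := hT' σ κ τ
    rw [h1, h2, h0' p, mul_zero] at this
    exact (mul_eq_zero.1 this.symm).resolve_left (sgn_ne σ κ)
  · obtain ⟨σ, h1, h2, h3⟩ := bad_sign κ.2.1 τ.2.1 hG
    have h1' := (ivc_iff σ κ κ).2 (fun x => (h1 x).symm)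
    have h2' := (ivc_iff σ τ τ).2 (fun x => (h2 x).symm)
    have := hT' σ κ τ
    rw [h1', h2', h3] at this
    push_cast at this
    have h4 : (Ssign σ τ.1 : ℂ) * T (Pi.single τ 1) κ = 0 := by
      linear_combination (1 / 2 : ℂ) * this
    exact (mul_eq_zero.1 h4).resolve_left (sgn_ne σ τ)

theorem toLin_single {X : Type*} [Fintype X] [DecidableEq X] (M : Matrix X X ℂ) (κ τ : X) :
    Matrix.toLin' M (Pi.single τ 1) κ = M κ τ := by
  simp [Matrix.toLin'_apply]

theorem evalMap_surj (y : PP N j → InvolJ N j × InvolJ N j)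
    (hy : ∀ p, HasType (y p).1.1 (y p).2.1 p.1) : Function.Surjective (evalMap y) := by
  classical
  intro f
  let Q : InvolJ N j → InvolJ N j → PP N j × Perm (Fin N) → Prop := fun κ τ u =>
    involConj u.2 (y u.1).1 = κ ∧ involConj u.2 (y u.1).2 = τ
  let V : PP N j × Perm (Fin N) → ℂ := fun u =>
    Ssign u.2 (y u.1).1.1 * Ssign u.2 (y u.1).2.1 * f u.1
  let M : Matrix (InvolJ N j) (InvolJ N j) ℂ := fun κ τ =>
    if h : ∃ u, Q κ τ u then V h.choose else 0
  have hV : ∀ κ τ u u', Q κ τ u → Q κ τ u' → V u = V u' := by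
    rintro κ τ ⟨p, σ⟩ ⟨p', σ'⟩ h h'
    have hp : p = p' := by
      apply Subtype.ext
      have e1 := (hy p).conj σ⁻¹ (k' := κ.1) (l' := τ.1) ((intw_iff _ _ _ _ _).2
        ⟨by rw [← h.1, ivc_inv], by rw [← h.2, ivc_inv]⟩)
      have e2 := (hy p').conj σ'⁻¹ (k' := κ.1) (l' := τ.1) ((intw_iff _ _ _ _ _).2
        ⟨by rw [← h'.1, ivc_inv], by rw [← h'.2, ivc_inv]⟩)
      exact e1.unique e2
    subst hp
    obtain ⟨a, b⟩ := h
    obtain ⟨a', b'⟩ := h'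
    simp only at a b a' b'
    have r1 : involConj (σ'⁻¹ * σ) (y p).1 = (y p).1 := by
      rw [ivc_mul, a, ← a', ivc_inv]
    have r2 : involConj (σ'⁻¹ * σ) (y p).2 = (y p).2 := by
      rw [ivc_mul, b, ← b', ivc_inv]
    obtain ⟨g1, g2, g3, -⟩ := (hy p).good
    have hs := good_sign g1 g2 g3 (σ := σ'⁻¹ * σ)
      (fun x => ((ivc_iff _ _ _).1 r1 x).symm) (fun x => ((ivc_iff _ _ _).1 r2 x).symm)
    have s1 := sgn_mul σ' (σ'⁻¹ * σ) (y p).1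
    have s2 := sgn_mul σ' (σ'⁻¹ * σ) (y p).2
    rw [r1, mul_inv_cancel_left, hs] at s1
    rw [r2, mul_inv_cancel_left] at s2
    have s3 := sgn_sq (σ'⁻¹ * σ) (y p).2
    simp only [V]
    rw [s1, s2]
    linear_combination (Ssign σ' (y p).1.1 * Ssign σ' (y p).2.1 * f p : ℂ) * s3
  have hM : ∀ κ τ u, Q κ τ u → M κ τ = V u := by
    intro κ τ u hu
    have hex : ∃ u, Q κ τ u := ⟨u, hu⟩
    simp only [M]
    rw [dif_pos hex]
    exact hV κ τ _ _ hex.choose_spec hu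
  have hM0 : ∀ κ τ, (¬ ∃ u, Q κ τ u) → M κ τ = 0 := by
    intro κ τ h
    simp only [M]
    rw [dif_neg h]
  have hTM : ∀ κ τ, Matrix.toLin' M (Pi.single τ 1) κ = M κ τ := by
    intro κ τ
    exact toLin_single M κ τ
  clear_value M
  have hmem : Matrix.toLin' M ∈ EndG N j := by
    rw [mem_EndG]
    intro σ κ τ
    rw [hTM, hTM]
    by_cases h : ∃ u, Q κ τ u
    · obtain ⟨⟨p, ρ⟩, h⟩ := h
      have h' : Q (involConj σ κ) (involConj σ τ) (p, σ * ρ) :=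
        ⟨by simp only [ivc_mul]; rw [h.1], by simp only [ivc_mul]; rw [h.2]⟩
      rw [hM _ _ _ h, hM _ _ _ h']
      simp only [V]
      obtain ⟨a, b⟩ := h
      simp only at a b
      rw [sgn_mul, sgn_mul, a, b]
      linear_combination (Ssign σ κ.1 * Ssign ρ (y p).1.1 * Ssign ρ (y p).2.1 * f p : ℂ) *
        sgn_sq σ τ
    · have h' : ¬ ∃ u, Q (involConj σ κ) (involConj σ τ) u := by
        rintro ⟨⟨p, ρ⟩, a, b⟩
        refine h ⟨(p, σ⁻¹ * ρ), ?_, ?_⟩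
        · simp only at a ⊢; rw [ivc_mul, a, ivc_inv]
        · simp only at b ⊢; rw [ivc_mul, b, ivc_inv]
      rw [hM0 _ _ h, hM0 _ _ h', mul_zero, mul_zero]
  refine ⟨⟨Matrix.toLin' M, hmem⟩, ?_⟩
  funext p
  show Matrix.toLin' M (Pi.single (y p).2 1) (y p).1 = f p
  rw [hTM, hM _ _ (p, 1) ⟨ivc_one _, ivc_one _⟩]
  have h1 : ∀ τ : InvolJ N j, Ssign 1 τ.1 = 1 := by
    intro τ
    have h0 : (Finset.univ.filter (fun p : Fin N × Fin N =>
        p.1 < p.2 ∧ τ.1 p.1 = p.2 ∧ (1 : Perm (Fin N)) p.2 < (1 : Perm (Fin N)) p.1)) = ∅ := by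
      apply Finset.filter_eq_empty_iff.2
      rintro ⟨a, b⟩ _ ⟨h, _, h'⟩
      exact lt_asymm h h'
    rw [Ssign, h0]; simp
  simp [V, h1]

end Final

/-- The dimension of End_{Σ_N}(V_j) equals the number of partitions of N with
exactly N − 2j odd parts. -/
theorem finrank_EndG (N j : ℕ) (hj : j ≤ N / 2) :
    Module.finrank ℂ (EndG N j) =
      Fintype.card {p : Nat.Partition N //
        (p.parts.filter fun x => Odd x).card = N - 2 * j} := by
  choose y hy using exists_y (N := N) (j := j) hj
  have e := LinearEquiv.ofBijective (evalMap y) ⟨evalMap_inj y hy, evalMap_surj y hy⟩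
  rw [e.finrank_eq, Module.finrank_fintype_fun_eq_card]
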